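/- Let A be a strongly abelian algebra such that for every substructure B of A × A and every congruence θ on B, the quotient B/θ is abelian. Then for every substructure B of A and every congruence θ on B, the quotient B/θ is strongly abelian. -/

import Mathlib

namespace UA

/-- An algebraic language: a type of operation symbols with arities. -/
structure Lang where
  F : Type
  arity : F → ℕ

variable {L : Lang}

/-- An interpretation of the language `L` on the carrier `A` (an algebra structure). -/
def Interp (L : Lang) (A : Type) : Type :=
  (f : L.F) → ((Fin (L.arity f)) → A) → A

/-- Terms of the language `L` over a type `X` of variables. -/
inductive Term (L : Lang) (X : Type) : Type
  | var : X → Term L X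
  | app : (f : L.F) → ((Fin (L.arity f)) → Term L X) → Term L X

/-- Realization of a term under an assignment of the variables. -/
def Term.realize {A X : Type} (I : Interp L A) (v : X → A) : Term L X → A
  | .var x => v x
  | .app f ts => I f (fun i => (ts i).realize I v)

/-- Relabelling (substitution of variables) of terms. -/
def Term.relabel {X Y : Type} (g : X → Y) : Term L X → Term L Y
  | .var x => .var (g x)
  | .app f ts => .app f (fun i => (ts i).relabel g)

/-- `p` is a polynomial operation of the algebra `(A, I)` with argument-index type `X`:
it is the realization of a term in variables `X ⊕ Fin m` where the `Fin m` variables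
are evaluated at fixed constants. -/
def IsPolyOp {A X : Type} (I : Interp L A) (p : (X → A) → A) : Prop :=
  ∃ (m : ℕ) (t : Term L (X ⊕ Fin m)) (c : Fin m → A),
    ∀ x : X → A, p x = t.realize I (Sum.elim x c)

/-- A unary polynomial operation. -/
def IsUnaryPolyOp {A : Type} (I : Interp L A) (g : A → A) : Prop :=
  IsPolyOp I (fun x : Fin 1 → A => g (x 0))

/-- `(p, q, r, s)` is a `1,1`-matrix of the algebra `(A, I)`. -/
def Is11Matrix {A : Type} (I : Interp L A) (p q r s : A) : Prop :=
  ∃ (k l : ℕ) (t : ((Fin k ⊕ Fin l) → A) → A), IsPolyOp I t ∧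
    ∃ (a b : Fin k → A) (u v : Fin l → A),
      p = t (Sum.elim a u) ∧ q = t (Sum.elim a v) ∧
      r = t (Sum.elim b u) ∧ s = t (Sum.elim b v)

/-- The algebra is abelian: in every `1,1`-matrix, `p = q` implies `r = s`. -/
def IsAbelian {A : Type} (I : Interp L A) : Prop :=
  ∀ p q r s : A, Is11Matrix I p q r s → p = q → r = s

/-- The algebra is strongly rectangular: in every `1,1`-matrix, `q = r` implies `r = s`. -/
def IsStronglyRectangular {A : Type} (I : Interp L A) : Prop :=
  ∀ p q r s : A, Is11Matrix I p q r s → q = r → r = s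

/-- Strongly abelian = abelian + strongly rectangular. -/
def IsStronglyAbelian {A : Type} (I : Interp L A) : Prop :=
  IsAbelian I ∧ IsStronglyRectangular I

/-- The algebra has a Maltsev polynomial operation. -/
def HasMaltsevPoly {A : Type} (I : Interp L A) : Prop :=
  ∃ mOp : (Fin 3 → A) → A, IsPolyOp I mOp ∧
    ∀ x y : A, mOp ![x, y, y] = x ∧ mOp ![y, y, x] = x

/-- Affine = abelian + has a Maltsev polynomial operation. -/
def IsAffine {A : Type} (I : Interp L A) : Prop :=
  IsAbelian I ∧ HasMaltsevPoly I

/-- The algebra satisfies the identity `e.1 ≈ e.2`. -/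
def Satisfies {A : Type} (I : Interp L A) (e : Term L ℕ × Term L ℕ) : Prop :=
  ∀ v : ℕ → A, e.1.realize I v = e.2.realize I v

/-- Membership in the variety `Mod(E)` axiomatized by the set `E` of identities. -/
def InVariety {A : Type} (E : Set (Term L ℕ × Term L ℕ)) (I : Interp L A) : Prop :=
  ∀ e ∈ E, Satisfies I e

/-- `θ` is a congruence on the algebra `(A, I)`. -/
def IsCong {A : Type} (I : Interp L A) (θ : A → A → Prop) : Prop :=
  Equivalence θ ∧
    ∀ (f : L.F) (a b : Fin (L.arity f) → A),
      (∀ i, θ (a i) (b i)) → θ (I f a) (I f b)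

/-- `(p, q, r, s)` is a `θ`-matrix of the algebra `(A, I)`. -/
def IsThetaMatrix {A : Type} (I : Interp L A) (θ : A → A → Prop) (p q r s : A) : Prop :=
  ∃ (k l : ℕ) (t : ((Fin k ⊕ Fin l) → A) → A), IsPolyOp I t ∧
    ∃ (a b : Fin k → A) (u v : Fin l → A),
      (∀ i, θ (a i) (b i)) ∧ (∀ j, θ (u j) (v j)) ∧
      p = t (Sum.elim a u) ∧ q = t (Sum.elim a v) ∧
      r = t (Sum.elim b u) ∧ s = t (Sum.elim b v)

/-- `θ` is a strongly abelian congruence. -/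
def IsStronglyAbelianCong {A : Type} (I : Interp L A) (θ : A → A → Prop) : Prop :=
  ∀ p q r s : A, IsThetaMatrix I θ p q r s → (p = q → r = s) ∧ (q = r → r = s)

/-- `S` is a subuniverse of the algebra `(A, I)`. -/
def IsSubuniverse {A : Type} (I : Interp L A) (S : Set A) : Prop :=
  ∀ (f : L.F) (a : Fin (L.arity f) → A), (∀ i, a i ∈ S) → I f a ∈ S

/-- The substructure (restricted algebra structure) on a subuniverse. -/
def subInterp {A : Type} (I : Interp L A) (S : Set A) (hS : IsSubuniverse I S) :
    Interp L S :=
  fun f a => ⟨I f (fun i => (a i : A)), hS f _ (fun i => (a i).2)⟩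

/-- The componentwise algebra structure on a product. -/
def prodInterp {ι : Type} {A : ι → Type} (I : ∀ i, Interp L (A i)) :
    Interp L (∀ i, A i) :=
  fun f a i => I i f (fun j => a j i)

/-- The componentwise algebra structure on `A × A`. -/
def pairInterp {A : Type} (I : Interp L A) : Interp L (A × A) :=
  fun f a => (I f (fun i => (a i).1), I f (fun i => (a i).2))

/-- `h` is a homomorphism of `L`-algebras. -/
def IsHom {A B : Type} (I : Interp L A) (J : Interp L B) (h : A → B) : Prop :=
  ∀ (f : L.F) (a : Fin (L.arity f) → A), h (I f a) = J f (fun i => h (a i))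

/-- The induced algebra structure on the quotient by a congruence `ρ`
(well-defined, i.e. independent of the chosen representatives, when `ρ` is a congruence). -/
noncomputable def quotInterp {A : Type} (I : Interp L A) (ρ : A → A → Prop) :
    Interp L (Quot ρ) :=
  fun f a => Quot.mk ρ (I f (fun i => (a i).out))

/-- The subuniverse generated by a subset `G`: the intersection of all
subuniverses containing `G`. -/
def GenSub {A : Type} (I : Interp L A) (G : Set A) : Set A :=
  {x | ∀ S : Set A, IsSubuniverse I S → G ⊆ S → x ∈ S}

theorem genSub_isSubuniverse {A : Type} (I : Interp L A) (G : Set A) :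
    IsSubuniverse I (GenSub I G) :=
  fun f a ha S hS hG => hS f a (fun i => ha i S hS hG)

/-- The smallest congruence containing the pair `(x, y)`: the intersection of all
congruences containing it. -/
def genCong {A : Type} (I : Interp L A) (x y : A) : A → A → Prop :=
  fun w z => ∀ ρ : A → A → Prop, IsCong I ρ → ρ x y → ρ w z

/-- The carrier of `A(θ)`, the graph of `θ` inside `A × A`. -/
abbrev ThetaSub {A : Type} (θ : A → A → Prop) : Type := {z : A × A // θ z.1 z.2}

/-- The substructure `A(θ) ≤ A × A` supported by the graph of `θ`. -/
def thetaSubInterp {A : Type} (I : Interp L A) (θ : A → A → Prop) (hθ : IsCong I θ) :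
    Interp L (ThetaSub θ) :=
  fun f a => ⟨(I f (fun i => (a i).1.1), I f (fun i => (a i).1.2)),
    hθ.2 f _ _ (fun i => (a i).2)⟩

/-- The diagonal element `(c, c)` of `A(θ)`. -/
def diagEl {A : Type} {θ : A → A → Prop} (hrefl : ∀ a : A, θ a a) (c : A) :
    ThetaSub θ := ⟨(c, c), hrefl c⟩

/-- `Δ`: the smallest congruence of `A(θ)` containing `D × D`, where `D` is the
diagonal -- the intersection of all congruences of `A(θ)` containing `D × D`. -/
def DeltaRel {A : Type} (I : Interp L A) (θ : A → A → Prop) (hθ : IsCong I θ) :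
    ThetaSub θ → ThetaSub θ → Prop :=
  fun x y => ∀ ρ : ThetaSub θ → ThetaSub θ → Prop,
    IsCong (thetaSubInterp I θ hθ) ρ →
    (∀ c d : A, ρ (diagEl hθ.1.refl c) (diagEl hθ.1.refl d)) → ρ x y

/-- The quotient algebra `S = A(θ)/Δ`. -/
noncomputable def SInterp {A : Type} (I : Interp L A) (θ : A → A → Prop)
    (hθ : IsCong I θ) : Interp L (Quot (DeltaRel I θ hθ)) :=
  quotInterp (thetaSubInterp I θ hθ) (DeltaRel I θ hθ)

/-- The element `0` of `S = A(θ)/Δ`: the `Δ`-class of a diagonal element. -/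
def zeroS {A : Type} (I : Interp L A) (θ : A → A → Prop) (hθ : IsCong I θ) (d : A) :
    Quot (DeltaRel I θ hθ) :=
  Quot.mk _ (diagEl hθ.1.refl d)

/-- The diagonal of `B × B`. -/
def diagSet (B : Type) : Set (B × B) := {z | z.1 = z.2}

/-- The set of pairs `(u j, v j)`. -/
def pairsSet {B : Type} {l : ℕ} (u v : Fin l → B) : Set (B × B) :=
  {z | ∃ j, z = (u j, v j)}

/-- The carrier of the subalgebra `C ≤ B × B` generated by the diagonal and the
pairs `(u j, v j)`. -/
def CsetOf {L : Lang} {B : Type} (I : Interp L B) {l : ℕ} (u v : Fin l → B) :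
    Set (B × B) :=
  GenSub (pairInterp I) (diagSet B ∪ pairsSet u v)

/-- The subalgebra `C ≤ B × B` generated by the diagonal and the pairs `(u j, v j)`. -/
def CInterpOf {L : Lang} {B : Type} (I : Interp L B) {l : ℕ} (u v : Fin l → B) :
    Interp L (CsetOf I u v) :=
  subInterp (pairInterp I) _ (genSub_isSubuniverse _ _)


/-! ### Terms, homomorphisms and congruences -/

/-- Substitution of terms for the variables of a term. -/
def Term.subst {X Y : Type} (g : X → Term L Y) : Term L X → Term L Y
  | .var x => g x
  | .app f ts => .app f (fun i => (ts i).subst g)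

theorem Term.realize_relabel {A X Y : Type} (I : Interp L A) (g : X → Y) (v : Y → A)
    (T : Term L X) : (T.relabel g).realize I v = T.realize I (fun x => v (g x)) := by
  induction T with
  | var x => rfl
  | app f ts ih => simp only [Term.relabel, Term.realize, ih]

theorem Term.realize_subst {A X Y : Type} (I : Interp L A) (g : X → Term L Y) (v : Y → A)
    (T : Term L X) : (T.subst g).realize I v = T.realize I (fun x => (g x).realize I v) := by
  induction T with
  | var x => rfl
  | app f ts ih => simp only [Term.subst, Term.realize, ih]

theorem Term.relabel_relabel {X Y Z : Type} (p : X → Y) (q : Y → Z) (T : Term L X) :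
    (T.relabel p).relabel q = T.relabel (fun x => q (p x)) := by
  induction T with
  | var x => rfl
  | app f ts ih => simp only [Term.relabel, ih]

theorem Term.exists_relabel_fin {X : Type} (T : Term L X) :
    ∃ (n : ℕ) (T' : Term L (Fin n)) (g : Fin n → X), T = T'.relabel g := by
  induction T with
  | var x => exact ⟨1, .var 0, fun _ => x, rfl⟩
  | app f ts ih =>
    choose n T' g h using ih
    let e := Fintype.equivFin (Σ i, Fin (n i))
    refine ⟨_, .app f (fun i => (T' i).relabel (fun j => e ⟨i, j⟩)),
      fun k => g (e.symm k).1 (e.symm k).2, ?_⟩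
    have hg : ∀ i j, g (e.symm (e ⟨i, j⟩)).1 (e.symm (e ⟨i, j⟩)).2 = g i j := by
      intro i j
      rw [Equiv.symm_apply_apply]
    simp only [Term.relabel, Term.relabel_relabel, hg]
    congr 1
    exact funext h

theorem IsHom.map_realize {A B X : Type} {I : Interp L A} {J : Interp L B} {h : A → B}
    (hh : IsHom I J h) (T : Term L X) (v : X → A) :
    h (T.realize I v) = T.realize J (fun x => h (v x)) := by
  induction T with
  | var x => rfl
  | app f ts ih => simp only [Term.realize, hh f, ih]

theorem IsCong.realize {A X : Type} {I : Interp L A} {θ : A → A → Prop} (hθ : IsCong I θ)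
    (T : Term L X) {v w : X → A} (h : ∀ x, θ (v x) (w x)) :
    θ (T.realize I v) (T.realize I w) := by
  induction T with
  | var x => exact h x
  | app f ts ih => exact hθ.2 f _ _ ih

theorem IsCong.mk_eq_iff {A : Type} {I : Interp L A} {θ : A → A → Prop} (hθ : IsCong I θ)
    {x y : A} : Quot.mk θ x = Quot.mk θ y ↔ θ x y :=
  Quot.eq.trans hθ.1.eqvGen_iff

theorem IsCong.isHom_mk {A : Type} {I : Interp L A} {θ : A → A → Prop} (hθ : IsCong I θ) :
    IsHom I (quotInterp I θ) (Quot.mk θ) := fun f a =>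
  Quot.sound (hθ.2 f _ _ fun i => hθ.mk_eq_iff.1 (Quot.out_eq (Quot.mk θ (a i))).symm)

theorem IsCong.comap {A B : Type} {I : Interp L A} {J : Interp L B} {h : A → B}
    {θ : B → B → Prop} (hθ : IsCong J θ) (hh : IsHom I J h) :
    IsCong I (fun x y => θ (h x) (h y)) := by
  refine ⟨⟨fun _ => hθ.1.refl _, fun H => hθ.1.symm H, fun H H' => hθ.1.trans H H'⟩, ?_⟩
  intro f a b hab
  rw [hh f, hh f]
  exact hθ.2 f _ _ hab

theorem isHom_fst {A : Type} (I : Interp L A) : IsHom (pairInterp I) I Prod.fst :=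
  fun _ _ => rfl

theorem isHom_snd {A : Type} (I : Interp L A) : IsHom (pairInterp I) I Prod.snd :=
  fun _ _ => rfl

theorem realize_pairInterp {A X : Type} (I : Interp L A) (T : Term L X) (v : X → A × A) :
    T.realize (pairInterp I) v =
      (T.realize I (fun x => (v x).1), T.realize I (fun x => (v x).2)) :=
  Prod.ext ((isHom_fst I).map_realize T v) ((isHom_snd I).map_realize T v)

/-! ### Term conditions modulo a relation -/

/-- The term condition modulo `θ`, for terms over arbitrary blocks of variables. -/
def TermCond {A : Type} (I : Interp L A) (θ : A → A → Prop) : Prop :=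
  ∀ (X Y : Type) (T : Term L (X ⊕ Y)) (a b : X → A) (u v : Y → A),
    θ (T.realize I (Sum.elim a u)) (T.realize I (Sum.elim a v)) →
      θ (T.realize I (Sum.elim b u)) (T.realize I (Sum.elim b v))

/-- The strong rectangularity condition modulo `θ`, for terms over arbitrary blocks of
variables. -/
def TermRect {A : Type} (I : Interp L A) (θ : A → A → Prop) : Prop :=
  ∀ (X Y : Type) (T : Term L (X ⊕ Y)) (a b : X → A) (u v : Y → A),
    θ (T.realize I (Sum.elim a v)) (T.realize I (Sum.elim b u)) →
      θ (T.realize I (Sum.elim b u)) (T.realize I (Sum.elim b v))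

theorem is11Matrix_realize {A X Y : Type} (I : Interp L A) (T : Term L (X ⊕ Y))
    (a b : X → A) (u v : Y → A) :
    Is11Matrix I (T.realize I (Sum.elim a u)) (T.realize I (Sum.elim a v))
      (T.realize I (Sum.elim b u)) (T.realize I (Sum.elim b v)) := by
  obtain ⟨n, T', g, rfl⟩ := T.exists_relabel_fin
  let split : Fin n → Fin n ⊕ Fin n := fun i => (g i).elim (fun _ => .inl i) (fun _ => .inr i)
  have key : ∀ (c : X → A) (w : Y → A),
      (T'.relabel g).realize I (Sum.elim c w) =
        T'.realize I (fun i => Sum.elim (fun i => Sum.elim c u (g i))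
          (fun i => Sum.elim a w (g i)) (split i)) := by
    intro c w
    rw [Term.realize_relabel]
    congr 1
    funext i
    simp only [split]
    rcases h : g i with x | y <;> simp [h]
  refine ⟨n, n, fun z => T'.realize I (fun i => z (split i)),
    ⟨0, T'.relabel (fun i => .inl (split i)), Fin.elim0, fun z => ?_⟩,
    fun i => Sum.elim a u (g i), fun i => Sum.elim b u (g i),
    fun i => Sum.elim a u (g i), fun i => Sum.elim a v (g i),
    key a u, key a v, key b u, key b v⟩
  rw [Term.realize_relabel]
  rfl

theorem IsAbelian.termCond {A : Type} {I : Interp L A} (h : IsAbelian I) :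
    TermCond I Eq :=
  fun _ _ T a b u v => h _ _ _ _ (is11Matrix_realize I T a b u v)

theorem IsStronglyRectangular.termRect {A : Type} {I : Interp L A}
    (h : IsStronglyRectangular I) : TermRect I Eq :=
  fun _ _ T a b u v => h _ _ _ _ (is11Matrix_realize I T a b u v)

theorem TermCond.comap {A B : Type} {I : Interp L A} {J : Interp L B} {h : A → B}
    {θ : B → B → Prop} (hθ : TermCond J θ) (hh : IsHom I J h) :
    TermCond I (fun x y => θ (h x) (h y)) := by
  intro X Y T a b u v
  simp only [hh.map_realize, ← Function.comp_apply (f := h),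
    Sum.comp_elim]
  exact hθ X Y T _ _ _ _

theorem TermRect.comap {A B : Type} {I : Interp L A} {J : Interp L B} {h : A → B}
    {θ : B → B → Prop} (hθ : TermRect J θ) (hh : IsHom I J h) :
    TermRect I (fun x y => θ (h x) (h y)) := by
  intro X Y T a b u v
  simp only [hh.map_realize, ← Function.comp_apply (f := h),
    Sum.comp_elim]
  exact hθ X Y T _ _ _ _

theorem TermCond.of_comap {A B : Type} {I : Interp L A} {J : Interp L B} {h : A → B}
    {g : B → A} {θ : B → B → Prop} (hθ : TermCond I (fun x y => θ (h x) (h y)))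
    (hh : IsHom I J h) (hg : Function.RightInverse g h) : TermCond J θ := by
  intro X Y T a b u v
  have H := hθ X Y T (g ∘ a) (g ∘ b) (g ∘ u) (g ∘ v)
  simpa only [hh.map_realize, ← Sum.comp_elim, Function.comp_apply, hg _] using H

theorem IsAbelian.termCond_quot {A : Type} {I : Interp L A} {θ : A → A → Prop}
    (hθ : IsCong I θ) (h : IsAbelian (quotInterp I θ)) : TermCond I θ := by
  have H := h.termCond.comap hθ.isHom_mk
  simpa only [hθ.mk_eq_iff] using H

/-- Every `1,1`-matrix of a quotient lifts to a matrix of term values. -/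
theorem IsCong.exists_lift_of_is11Matrix {A : Type} {I : Interp L A} {θ : A → A → Prop}
    (hθ : IsCong I θ) {p q r s : Quot θ} (h : Is11Matrix (quotInterp I θ) p q r s) :
    ∃ (X Y : Type) (T : Term L (X ⊕ Y)) (a b : X → A) (u v : Y → A),
      p = Quot.mk θ (T.realize I (Sum.elim a u)) ∧
      q = Quot.mk θ (T.realize I (Sum.elim a v)) ∧
      r = Quot.mk θ (T.realize I (Sum.elim b u)) ∧
      s = Quot.mk θ (T.realize I (Sum.elim b v)) := by
  obtain ⟨k, l, t, ⟨m, T, c, hT⟩, a, b, u, v, rfl, rfl, rfl, rfl⟩ := h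
  let split : (Fin k ⊕ Fin l) ⊕ Fin m → (Fin k ⊕ Fin m) ⊕ Fin l :=
    Sum.elim (Sum.elim (fun i => .inl (.inl i)) .inr) (fun i => .inl (.inr i))
  have key : ∀ (d : Fin k → Quot θ) (w : Fin l → Quot θ),
      t (Sum.elim d w) = Quot.mk θ ((T.relabel split).realize I
        (Sum.elim (Sum.elim (fun i => (d i).out) (fun i => (c i).out))
          (fun i => (w i).out))) := by
    intro d w
    rw [hT, hθ.isHom_mk.map_realize, Term.realize_relabel]
    congr 1
    funext i
    rcases i with (i | i) | i <;> simp [split]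
  exact ⟨_, _, T.relabel split, _, _, _, _, key a u, key a v, key b u, key b v⟩

theorem TermCond.isAbelian_quot {A : Type} {I : Interp L A} {θ : A → A → Prop}
    (hθ : IsCong I θ) (h : TermCond I θ) : IsAbelian (quotInterp I θ) := by
  intro p q r s hm hpq
  obtain ⟨X, Y, T, a, b, u, v, rfl, rfl, rfl, rfl⟩ := hθ.exists_lift_of_is11Matrix hm
  exact hθ.mk_eq_iff.2 (h X Y T a b u v (hθ.mk_eq_iff.1 hpq))

theorem TermRect.isStronglyRectangular_quot {A : Type} {I : Interp L A} {θ : A → A → Prop}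
    (hθ : IsCong I θ) (h : TermRect I θ) : IsStronglyRectangular (quotInterp I θ) := by
  intro p q r s hm hqr
  obtain ⟨X, Y, T, a, b, u, v, rfl, rfl, rfl, rfl⟩ := hθ.exists_lift_of_is11Matrix hm
  exact hθ.mk_eq_iff.2 (h X Y T a b u v (hθ.mk_eq_iff.1 hqr))

/-! ### The syntactic congruence of a subset -/

/-- The largest congruence for which the set `Z` is a union of classes: two elements are
related if no unary polynomial operation separates them with respect to `Z`. -/
def syntacticCong {A : Type} (I : Interp L A) (Z : Set A) (x y : A) : Prop :=
  ∀ (V : Type) (K : Term L (Option V)) (c : V → A),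
    K.realize I (fun o => o.elim x c) ∈ Z ↔ K.realize I (fun o => o.elim y c) ∈ Z

theorem syntacticCong.realize_update {A W : Type} {I : Interp L A} {Z : Set A} {x y : A}
    (h : syntacticCong I Z x y) [DecidableEq W] (K : Term L W) (w : W → A) (j : W) :
    K.realize I (Function.update w j x) ∈ Z ↔ K.realize I (Function.update w j y) ∈ Z := by
  have H := h W (K.relabel (fun i => if i = j then none else some i)) w
  have key : ∀ z : A, (K.relabel (fun i => if i = j then none else some i)).realize I
      (fun o => o.elim z w) = K.realize I (Function.update w j z) := by
    intro z
    rw [Term.realize_relabel]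
    congr 1
    funext i
    by_cases hi : i = j <;> simp [hi]
  rwa [key, key] at H

theorem syntacticCong_isCong {A : Type} (I : Interp L A) (Z : Set A) :
    IsCong I (syntacticCong I Z) := by
  classical
  refine ⟨⟨fun _ _ _ _ => Iff.rfl, fun h V K c => (h V K c).symm,
    fun h h' V K c => (h V K c).trans (h' V K c)⟩, ?_⟩
  intro f a b hab V K c
  let K' : Term L (Fin (L.arity f) ⊕ V) :=
    K.subst (fun o => o.elim (.app f (fun i => .var (.inl i))) (fun v => .var (.inr v)))
  have hK : ∀ d : Fin (L.arity f) → A,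
      K.realize I (fun o => o.elim (I f d) c) = K'.realize I (Sum.elim d c) := by
    intro d
    rw [Term.realize_subst]
    congr 1
    funext o
    cases o <;> rfl
  have step : ∀ s : Finset (Fin (L.arity f)),
      K'.realize I (Sum.elim a c) ∈ Z ↔ K'.realize I (Sum.elim (s.piecewise b a) c) ∈ Z := by
    intro s
    induction s using Finset.induction_on with
    | empty => simp
    | insert j s hj ih =>
      have H := (hab j).realize_update K' (Sum.elim (s.piecewise b a) c) (.inl j)
      rw [Sum.update_elim_inl, Sum.update_elim_inl] at H
      rw [ih, Finset.piecewise_insert, ← H]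
      have : Function.update (s.piecewise b a) j (a j) = s.piecewise b a := by
        rw [Function.update_eq_self_iff, Finset.piecewise_eq_of_notMem _ _ _ hj]
      rw [this]
  rw [hK, hK, step Finset.univ, Finset.piecewise_univ]

/-! ### Strong rectangularity of quotients -/

theorem TermRect.eq_of_realize_option_eq {B V : Type} {J : Interp L B} (h : TermRect J Eq)
    (K : Term L (Option V)) {x y : B} {w z : V → B}
    (hxy : K.realize J (fun o => o.elim x w) = K.realize J (fun o => o.elim y z)) :
    K.realize J (fun o => o.elim y z) = K.realize J (fun o => o.elim y w) := by
  have key : ∀ (e : B) (c : V → B),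
      (K.relabel (fun o => o.elim (.inl ()) .inr)).realize J
        (Sum.elim (fun _ : Unit => e) c) = K.realize J (fun o => o.elim e c) := by
    intro e c
    rw [Term.realize_relabel]
    congr 1
    funext o
    cases o <;> rfl
  have H := h Unit V (K.relabel (fun o => o.elim (.inl ()) .inr)) (fun _ => x) (fun _ => y) z w
  rw [key, key, key] at H
  exact H hxy

theorem TermCond.realize_option_eq {B X Y V : Type} {J : Interp L B} (h : TermCond J Eq)
    (T : Term L (X ⊕ Y)) (K : Term L (Option V)) {a b : X → B} {u v : Y → B} {w z : V → B}
    (huw : K.realize J (fun o => o.elim (T.realize J (Sum.elim a u)) w) =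
      K.realize J (fun o => o.elim (T.realize J (Sum.elim b u)) z)) :
    K.realize J (fun o => o.elim (T.realize J (Sum.elim a v)) w) =
      K.realize J (fun o => o.elim (T.realize J (Sum.elim b v)) z) := by
  let F : Term L (Y ⊕ (X ⊕ V)) := K.subst (fun o => o.elim
    (T.relabel (Sum.elim (fun x => .inr (.inl x)) .inl)) (fun i => .var (.inr (.inr i))))
  have key : ∀ (y : Y → B) (x : X → B) (c : V → B),
      F.realize J (Sum.elim y (Sum.elim x c)) =
        K.realize J (fun o => o.elim (T.realize J (Sum.elim x y)) c) := by
    intro y x c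
    rw [Term.realize_subst]
    congr 1
    funext o
    cases o with
    | none =>
      simp only [Option.elim_none, Term.realize_relabel]
      congr 1
      funext i
      cases i <;> rfl
    | some i => rfl
  have H := h Y (X ⊕ V) F u v (Sum.elim a w) (Sum.elim b z)
  rw [key, key, key, key] at H
  exact H huw

/-- If `B` satisfies both term conditions and all quotients of `B × B` satisfy the term
condition, then all quotients of `B` are strongly rectangular. -/
theorem termRect_of_square {B : Type} {J : Interp L B} (hab : TermCond J Eq)
    (hre : TermRect J Eq)
    (hsq : ∀ η, IsCong (pairInterp J) η → TermCond (pairInterp J) η)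
    {ρ : B → B → Prop} (hρ : IsCong J ρ) (hρab : TermCond J ρ) : TermRect J ρ := by
  intro X Y T a b u v hqr
  apply hρab X Y T a b u v
  set p := T.realize J (Sum.elim a u) with hp
  set q := T.realize J (Sum.elim a v) with hq
  set r := T.realize J (Sum.elim b u) with hr
  set s := T.realize J (Sum.elim b v) with hs
  let Z : Set (B × B) := {z | z.1 = z.2 ∧ ρ p z.1}
  have realize_opt : ∀ {V : Type} (K : Term L (Option V)) (c : V → B × B) (x y : B),
      K.realize (pairInterp J) (fun o => o.elim (x, y) c) =
        (K.realize J (fun o => o.elim x (fun i => (c i).1)),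
          K.realize J (fun o => o.elim y (fun i => (c i).2))) := by
    intro V K c x y
    rw [realize_pairInterp]
    congr 2 <;> funext o <;> cases o <;> rfl
  have hgen : syntacticCong (pairInterp J) Z (p, r) (q, s) := by
    intro V K c
    rw [realize_opt, realize_opt]
    have hrq : ρ (K.realize J (fun o => o.elim r (fun i => (c i).1)))
        (K.realize J (fun o => o.elim q (fun i => (c i).1))) := by
      apply hρ.realize
      intro o
      cases o with
      | none => exact hρ.1.symm hqr
      | some i => exact hρ.1.refl _
    constructor
    · rintro ⟨h, hd⟩
      refine ⟨hab.realize_option_eq T K h, hρ.1.trans hd ?_⟩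
      dsimp only at h ⊢
      rw [h, hre.eq_of_realize_option_eq K h]
      exact hrq
    · rintro ⟨h, hd⟩
      have h' := hab.realize_option_eq T K (v := u) h
      refine ⟨h', hρ.1.trans hd ?_⟩
      have h'' := hre.eq_of_realize_option_eq K h'
      dsimp only
      rw [h', h'']
      exact hρ.1.symm hrq
  have realize_blocks : ∀ (x x' : X → B) (y : Y → B),
      T.realize (pairInterp J) (Sum.elim (fun i => (x i, x' i)) (fun i => (y i, y i))) =
        (T.realize J (Sum.elim x y), T.realize J (Sum.elim x' y)) := by
    intro x x' y
    rw [realize_pairInterp]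
    congr 2 <;> funext i <;> cases i <;> rfl
  have hdiag := hsq _ (syntacticCong_isCong (pairInterp J) Z) X Y T
    (fun i => (a i, b i)) (fun i => (a i, a i)) (fun i => (u i, u i)) (fun i => (v i, v i))
  simp only [realize_blocks] at hdiag
  exact ((hdiag hgen Empty (.var none) Empty.elim).1 ⟨rfl, hρ.1.refl p⟩).2

/-- Let `A` be a strongly abelian algebra such that every quotient of
every substructure of `A × A` is abelian. Then every quotient of every substructure of
`A` is strongly abelian. -/
theorem statement17 {L : Lang} {A : Type} (I : Interp L A)
    (hA : IsStronglyAbelian I)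
    (hsq : ∀ (S : Set (A × A)) (hS : IsSubuniverse (pairInterp I) S)
      (ρ : S → S → Prop), IsCong (subInterp (pairInterp I) S hS) ρ →
      IsAbelian (quotInterp (subInterp (pairInterp I) S hS) ρ)) :
    ∀ (S : Set A) (hS : IsSubuniverse I S) (ρ : S → S → Prop),
      IsCong (subInterp I S hS) ρ →
      IsStronglyAbelian (quotInterp (subInterp I S hS) ρ) := by
  intro S hS ρ hρ
  have hcoe : IsHom (subInterp I S hS) I Subtype.val := fun _ _ => rfl
  have hab : TermCond (subInterp I S hS) Eq := by
    simpa only [Subtype.val_inj] using hA.1.termCond.comap hcoe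
  have hre : TermRect (subInterp I S hS) Eq := by
    simpa only [Subtype.val_inj] using hA.2.termRect.comap hcoe
  have hSS : IsSubuniverse (pairInterp I) (S ×ˢ S) := fun f a ha =>
    ⟨hS f _ fun i => (ha i).1, hS f _ fun i => (ha i).2⟩
  have hsquare : ∀ η, IsCong (pairInterp (subInterp I S hS)) η →
      TermCond (pairInterp (subInterp I S hS)) η := by
    intro η hη
    have hhom : IsHom (subInterp (pairInterp I) (S ×ˢ S) hSS) (pairInterp (subInterp I S hS))
        (fun z => (⟨z.1.1, z.2.1⟩, ⟨z.1.2, z.2.2⟩)) := fun _ _ => rfl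
    have hη' := hη.comap hhom
    exact ((hsq _ hSS _ hη').termCond_quot hη').of_comap hhom
      (g := fun z => ⟨(z.1.1, z.2.1), z.1.2, z.2.2⟩) fun _ => rfl
  have hρab : TermCond (subInterp I S hS) ρ :=
    (hsquare _ (hρ.comap (isHom_fst _))).of_comap (isHom_fst _) (g := fun x => (x, x))
      fun _ => rfl
  exact ⟨hρab.isAbelian_quot hρ,
    (termRect_of_square hab hre hsquare hρ hρab).isStronglyRectangular_quot hρ⟩

end UA
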